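/- Let f be in the Dirichlet space of the unit disk and B a finite Blaschke product. Then ‖fB‖²_𝒟 = ‖f‖²_𝒟 + (1/(2π))∫_𝕋 |f(ζ)|² |B'(ζ)| |dζ|, where ‖g‖²_𝒟 := (1/π)∫_𝔻 |g'|² dA. -/

import Mathlib

open MeasureTheory Finset Filter

noncomputable def ee (r θ : ℝ) : ℂ := (r : ℂ) * Complex.exp ((θ : ℂ) * Complex.I)

lemma norm_ee (r θ : ℝ) : ‖ee r θ‖ = |r| := by
  simp [ee, Complex.norm_exp_ofReal_mul_I]

lemma ee_mem {r : ℝ} (θ : ℝ) (h0 : 0 ≤ r) (h1 : r < 1) : ee r θ ∈ Metric.ball (0 : ℂ) 1 := by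
  simp [norm_ee, abs_of_nonneg h0, h1]

lemma ee_cont : Continuous (fun p : ℝ × ℝ => ee p.1 p.2) := by
  unfold ee; fun_prop

lemma ee_per (r θ : ℝ) : ee r (θ + 2 * Real.pi) = ee r θ := by
  unfold ee
  push_cast
  rw [add_mul, Complex.exp_add, Complex.exp_two_pi_mul_I, mul_one]

lemma ee_polar (p : ℝ × ℝ) : Complex.polarCoord.symm p = ee p.1 p.2 := by
  rw [Complex.polarCoord_symm_apply, ee, Complex.exp_mul_I, Complex.ofReal_cos, Complex.ofReal_sin]

lemma ee_hd1 (r θ : ℝ) : HasDerivAt (fun r : ℝ => ee r θ) (Complex.exp ((θ : ℂ) * Complex.I)) r := by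
  unfold ee
  simpa using (Complex.ofRealCLM.hasDerivAt (x := r)).mul_const (Complex.exp ((θ : ℂ) * Complex.I))

lemma ee_hd2 (r θ : ℝ) : HasDerivAt (fun θ : ℝ => ee r θ) (Complex.I * ee r θ) θ := by
  unfold ee
  have h : HasDerivAt (fun θ : ℝ => (θ : ℂ) * Complex.I) Complex.I θ := by
    simpa using (Complex.ofRealCLM.hasDerivAt (x := θ)).mul_const Complex.I
  exact ((h.cexp).const_mul (r : ℂ)).congr_deriv (by ring)

lemma polar_int (h : ℂ → ℝ) : ∫ z in Metric.ball (0 : ℂ) 1, h z =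
    ∫ p in Set.Ioo (0 : ℝ) 1 ×ˢ Set.Ioo (-Real.pi) Real.pi, p.1 * h (ee p.1 p.2) := by
  rw [← integral_indicator Metric.isOpen_ball.measurableSet, ← Complex.integral_comp_polarCoord_symm,
    polarCoord_target]
  have hs : Set.Ioo (0 : ℝ) 1 ×ˢ Set.Ioo (-Real.pi) Real.pi ⊆
    Set.Ioi (0 : ℝ) ×ˢ Set.Ioo (-Real.pi) Real.pi :=
    Set.prod_mono Set.Ioo_subset_Ioi_self subset_rfl
  rw [setIntegral_eq_of_subset_of_forall_sdiff_eq_zero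
    (measurableSet_Ioi.prod measurableSet_Ioo) hs]
  · refine setIntegral_congr_fun (measurableSet_Ioo.prod measurableSet_Ioo) ?_
    rintro p ⟨hp, -⟩
    simp only [ee_polar, smul_eq_mul]
    rw [Set.indicator_of_mem (ee_mem _ hp.1.le hp.2)]
  · rintro p ⟨⟨hp1, hp2⟩, hp3⟩
    have : ¬ p.1 < 1 := fun h => hp3 ⟨⟨hp1, h⟩, hp2⟩
    rw [ee_polar, Set.indicator_of_notMem]
    · simp
    · simp only [mem_ball_zero_iff, norm_ee, not_lt]
      rw [abs_of_pos hp1]; linarith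

lemma polar_cont {h : ℂ → ℝ} (hc : ContinuousOn h (Metric.ball (0 : ℂ) 1)) :
    ContinuousOn (fun p : ℝ × ℝ => p.1 * h (ee p.1 p.2)) (Set.Ico (0 : ℝ) 1 ×ˢ Set.univ) := by
  refine continuous_fst.continuousOn.mul (hc.comp ee_cont.continuousOn ?_)
  rintro p ⟨hp, -⟩
  exact ee_mem _ hp.1 hp.2

lemma polar_integrable {h : ℂ → ℝ} (hc : ContinuousOn h (Metric.ball (0 : ℂ) 1))
    (hi : IntegrableOn h (Metric.ball (0 : ℂ) 1)) :
    IntegrableOn (fun p : ℝ × ℝ => p.1 * h (ee p.1 p.2))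
      (Set.Ioo (0 : ℝ) 1 ×ˢ Set.Ioo (-Real.pi) Real.pi) := by
  have hs : Set.Ioo (0 : ℝ) 1 ×ˢ Set.Ioo (-Real.pi) Real.pi ⊆
    Set.Ioi (0 : ℝ) ×ˢ Set.Ioo (-Real.pi) Real.pi :=
    Set.prod_mono Set.Ioo_subset_Ioi_self subset_rfl
  refine ⟨((polar_cont hc).mono
    (Set.prod_mono Set.Ioo_subset_Ico_self (Set.subset_univ _))).aestronglyMeasurable
    (measurableSet_Ioo.prod measurableSet_Ioo), ?_⟩
  have h2 := hi.2
  rw [hasFiniteIntegral_iff_enorm] at h2 ⊢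
  rw [← lintegral_indicator Metric.isOpen_ball.measurableSet,
    ← Complex.lintegral_comp_polarCoord_symm, polarCoord_target] at h2
  refine lt_of_le_of_lt ?_ h2
  refine le_trans (le_of_eq ?_) (lintegral_mono_set hs)
  refine setLIntegral_congr_fun (measurableSet_Ioo.prod measurableSet_Ioo) ?_
  rintro p ⟨hp, -⟩
  simp only [ee_polar, smul_eq_mul]
  rw [Set.indicator_of_mem (ee_mem _ hp.1.le hp.2), enorm_mul, Real.enorm_of_nonneg hp.1.le]

lemma green_partial {g : ℂ → ℂ} (hg : AnalyticOnNhd ℂ g (Metric.ball (0 : ℂ) 1)) 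
    {r θ : ℝ} (h0 : 0 ≤ r) (h1 : r < 1) :
    let F : ℝ × ℝ → ℂ := fun p => star (g (ee p.1 p.2)) * (ee p.1 p.2 * deriv g (ee p.1 p.2))
    let G : ℝ × ℝ → ℂ := fun p => Complex.I * (star (g (ee p.1 p.2)) *
      (Complex.exp ((p.2 : ℂ) * Complex.I) * deriv g (ee p.1 p.2)))
    DifferentiableAt ℝ F (r, θ) ∧ DifferentiableAt ℝ G (r, θ) ∧
    fderiv ℝ F (r, θ) (1, 0) + fderiv ℝ G (r, θ) (0, 1) =
      ((2 * (r * ‖deriv g (ee r θ)‖ ^ 2) : ℝ) : ℂ) := by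
  intro F G
  have hz := ee_mem θ h0 h1
  have hg0 : HasDerivAt g (deriv g (ee r θ)) (ee r θ) := (hg _ hz).differentiableAt.hasDerivAt
  have hg1 : HasDerivAt (deriv g) (deriv (deriv g) (ee r θ)) (ee r θ) :=
    (hg _ hz).deriv.differentiableAt.hasDerivAt
  have hee : DifferentiableAt ℝ (fun p : ℝ × ℝ => ee p.1 p.2) (r, θ) := by
    unfold ee
    have : DifferentiableAt ℝ (fun p : ℝ × ℝ => (p.1 : ℂ)) (r, θ) :=
      Complex.ofRealCLM.differentiableAt.comp _ differentiableAt_fst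
    have h2 : DifferentiableAt ℝ (fun p : ℝ × ℝ => (p.2 : ℂ)) (r, θ) :=
      Complex.ofRealCLM.differentiableAt.comp _ differentiableAt_snd
    fun_prop
  have hex : DifferentiableAt ℝ (fun p : ℝ × ℝ => Complex.exp ((p.2 : ℂ) * Complex.I)) (r, θ) := by
    have h2 : DifferentiableAt ℝ (fun p : ℝ × ℝ => (p.2 : ℂ)) (r, θ) :=
      Complex.ofRealCLM.differentiableAt.comp _ differentiableAt_snd
    fun_prop
  have d0 : DifferentiableAt ℝ (fun p : ℝ × ℝ => g (ee p.1 p.2)) (r, θ) :=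
    DifferentiableAt.comp (r, θ) (hg0.differentiableAt.restrictScalars ℝ) hee
  have d1 : DifferentiableAt ℝ (fun p : ℝ × ℝ => deriv g (ee p.1 p.2)) (r, θ) :=
    DifferentiableAt.comp (r, θ) (g := deriv g) (hg1.differentiableAt.restrictScalars ℝ) hee
  have dF : DifferentiableAt ℝ F (r, θ) := d0.star.mul (hee.mul d1)
  have dG : DifferentiableAt ℝ G (r, θ) := (d0.star.mul (hex.mul d1)).const_mul _
  refine ⟨dF, dG, ?_⟩
  have c1 : HasDerivAt (fun r : ℝ => (r, θ)) ((1 : ℝ), (0 : ℝ)) r :=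
    (hasDerivAt_id r).prodMk (hasDerivAt_const _ _)
  have c2 : HasDerivAt (fun θ : ℝ => (r, θ)) ((0 : ℝ), (1 : ℝ)) θ :=
    (hasDerivAt_const _ _).prodMk (hasDerivAt_id θ)
  have e1 := HasFDerivAt.comp_hasDerivAt r (f := fun r : ℝ => (r, θ)) dF.hasFDerivAt c1
  have e2 := HasFDerivAt.comp_hasDerivAt θ (f := fun θ : ℝ => (r, θ)) dG.hasFDerivAt c2
  have p0 := HasDerivAt.comp r (h := fun r => ee r θ) hg0 (ee_hd1 r θ)
  have p1 := HasDerivAt.comp r (h := fun r => ee r θ) hg1 (ee_hd1 r θ)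
  have q0 := HasDerivAt.comp θ (h := fun θ => ee r θ) hg0 (ee_hd2 r θ)
  have q1 := HasDerivAt.comp θ (h := fun θ => ee r θ) hg1 (ee_hd2 r θ)
  have e1' := p0.star.mul ((ee_hd1 r θ).mul p1)
  have hx : HasDerivAt (fun θ : ℝ => Complex.exp ((θ : ℂ) * Complex.I))
      (Complex.I * Complex.exp ((θ : ℂ) * Complex.I)) θ := by
    simpa [ee] using ee_hd2 1 θ
  have e2' := (q0.star.mul (hx.mul q1)).const_mul Complex.I
  rw [e1.unique e1', e2.unique e2']
  simp only [Function.comp, Pi.mul_apply]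
  have hE : star (Complex.exp ((θ : ℂ) * Complex.I)) * Complex.exp ((θ : ℂ) * Complex.I) = 1 := by
    have := Complex.conj_mul' (Complex.exp ((θ : ℂ) * Complex.I))
    rw [Complex.norm_exp_ofReal_mul_I] at this
    simpa using this
  have hD : star (deriv g (ee r θ)) * deriv g (ee r θ) = ((‖deriv g (ee r θ)‖ : ℝ) : ℂ) ^ 2 := by
    simpa using Complex.conj_mul' (deriv g (ee r θ))
  have hr : star (r : ℂ) = r := by simp
  have hI : star Complex.I = - Complex.I := by simp
  have hI2 := Complex.I_sq
  push_cast
  rw [← hD]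
  generalize deriv g (ee r θ) = D at *
  generalize deriv (deriv g) (ee r θ) = D2 at *
  generalize g (ee r θ) = g0 at *
  simp only [ee, star_mul', hr, hI]
  generalize Complex.exp ((θ : ℂ) * Complex.I) = E at *
  generalize star E = E' at *
  generalize star D = D' at *
  generalize star g0 = g' at *
  linear_combination (2 * r * D * D') * hE + (g' * (E * D + r * E ^ 2 * D2) - E' * D' * r * E * D) * hI2

lemma green {g : ℂ → ℂ} (hg : AnalyticOnNhd ℂ g (Metric.ball (0 : ℂ) 1))
    {R : ℝ} (h0 : 0 < R) (h1 : R < 1) :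
    ((2 * ∫ p in Set.Ioo (0 : ℝ) R ×ˢ Set.Ioo (-Real.pi) Real.pi,
      p.1 * ‖deriv g (ee p.1 p.2)‖ ^ 2 : ℝ) : ℂ) =
    ∫ θ in (0 : ℝ)..(2 * Real.pi), star (g (ee R θ)) * (ee R θ * deriv g (ee R θ)) := by
  have hpi := Real.pi_pos
  have hdiff := fun r θ (a : 0 ≤ r) (b : r < 1) => green_partial hg (r := r) (θ := θ) a b
  simp only at hdiff
  set F : ℝ × ℝ → ℂ := fun p => star (g (ee p.1 p.2)) * (ee p.1 p.2 * deriv g (ee p.1 p.2)) with hF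
  set G : ℝ × ℝ → ℂ := fun p => Complex.I * (star (g (ee p.1 p.2)) *
      (Complex.exp ((p.2 : ℂ) * Complex.I) * deriv g (ee p.1 p.2))) with hG
  have hgc : ContinuousOn (fun z => ‖deriv g z‖ ^ 2) (Metric.ball (0 : ℂ) 1) :=
    (hg.deriv.continuousOn.norm).pow 2
  have hcont : ContinuousOn (fun p : ℝ × ℝ => p.1 * ‖deriv g (ee p.1 p.2)‖ ^ 2)
      (Set.Icc 0 R ×ˢ Set.Icc (-Real.pi) Real.pi) :=
    (polar_cont hgc).mono (Set.prod_mono (fun x hx => ⟨hx.1, hx.2.trans_lt h1⟩) (Set.subset_univ _))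
  have hint : IntegrableOn (fun p : ℝ × ℝ => p.1 * ‖deriv g (ee p.1 p.2)‖ ^ 2)
      (Set.Icc 0 R ×ˢ Set.Icc (-Real.pi) Real.pi) :=
    hcont.integrableOn_compact (isCompact_Icc.prod isCompact_Icc)
  have key := integral2_divergence_prod_of_hasFDerivAt_off_countable F G (fderiv ℝ F) (fderiv ℝ G)
    0 (-Real.pi) R Real.pi ∅ Set.countable_empty
  rw [Set.uIcc_of_le h0.le, Set.uIcc_of_le (by linarith), min_eq_left h0.le, max_eq_right h0.le,
    min_eq_left (by linarith), max_eq_right (by linarith)] at key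
  have hm : ∀ p ∈ Set.Icc 0 R ×ˢ Set.Icc (-Real.pi) Real.pi, 0 ≤ p.1 ∧ p.1 < 1 :=
    fun p hp => ⟨hp.1.1, hp.1.2.trans_lt h1⟩
  have key := key
    (fun p hp => (hdiff p.1 p.2 (hm p hp).1 (hm p hp).2).1.continuousAt.continuousWithinAt)
    (fun p hp => (hdiff p.1 p.2 (hm p hp).1 (hm p hp).2).2.1.continuousAt.continuousWithinAt)
    (fun p hp => (hdiff p.1 p.2 hp.1.1.1.le (hp.1.1.2.trans h1)).1.hasFDerivAt)
    (fun p hp => (hdiff p.1 p.2 hp.1.1.1.le (hp.1.1.2.trans h1)).2.1.hasFDerivAt)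
    (by
      refine IntegrableOn.congr_fun ((hint.const_mul 2).ofReal (𝕜 := ℂ)) ?_
        (measurableSet_Icc.prod measurableSet_Icc)
      intro p hp
      exact (hdiff p.1 p.2 (hm p hp).1 (hm p hp).2).2.2.symm)
  have eG : ∀ x, G (x, Real.pi) = G (x, -Real.pi) := by
    intro x
    have h1 : ee x Real.pi = ee x (-Real.pi) := by
      rw [← ee_per x (-Real.pi)]; congr 1; ring
    have h2 : Complex.exp ((Real.pi : ℂ) * Complex.I) =
        Complex.exp (((-Real.pi : ℝ) : ℂ) * Complex.I) := by
      simp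
    simp only [hG, h1, h2]
  have eF : ∀ y, F (0, y) = 0 := by intro y; simp [hF, ee]
  simp only [eG, eF, sub_self, zero_add, intervalIntegral.integral_zero, sub_zero] at key
  have per : Function.Periodic (fun y => F (R, y)) (2 * Real.pi) := by
    intro y; simp only [hF, ee_per]
  have hp := per.intervalIntegral_add_eq (-Real.pi) 0
  rw [show -Real.pi + 2 * Real.pi = Real.pi by ring, zero_add] at hp
  rw [← hp, ← key]
  have hint' := hint.mono_set (Set.prod_mono Set.Ioc_subset_Icc_self Set.Ioc_subset_Icc_self :
    Set.Ioc 0 R ×ˢ Set.Ioc (-Real.pi) Real.pi ⊆ _)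
  have haeq : (Set.Ioo (0 : ℝ) R ×ˢ Set.Ioo (-Real.pi) Real.pi : Set (ℝ × ℝ)) =ᵐ[volume]
      Set.Ioc 0 R ×ˢ Set.Ioc (-Real.pi) Real.pi :=
    Measure.set_prod_ae_eq Ioo_ae_eq_Ioc Ioo_ae_eq_Ioc
  rw [setIntegral_congr_set haeq, Measure.volume_eq_prod, setIntegral_prod _ hint',
    intervalIntegral.integral_of_le h0.le, ← integral_const_mul, ← integral_complex_ofReal]
  refine setIntegral_congr_fun measurableSet_Ioc ?_
  intro x hx
  simp only
  rw [intervalIntegral.integral_of_le (by linarith), ← integral_const_mul, ← integral_complex_ofReal]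
  refine setIntegral_congr_fun measurableSet_Ioc ?_
  intro y hy
  exact (hdiff x y hx.1.le (hx.2.trans_lt h1)).2.2.symm

lemma sq_int_le {u : ℝ → ℝ} {a b : ℝ} (hab : a < b) (hu : ContinuousOn u (Set.Icc a b)) :
    (∫ t in a..b, u t) ^ 2 ≤ (b - a) * ∫ t in a..b, u t ^ 2 := by
  have h1 : IntervalIntegrable u volume a b := by
    apply ContinuousOn.intervalIntegrable; rwa [Set.uIcc_of_le hab.le]
  have h2 : IntervalIntegrable (fun t => u t ^ 2) volume a b := by
    apply ContinuousOn.intervalIntegrable; rw [Set.uIcc_of_le hab.le]; exact hu.pow 2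
  set I1 := ∫ t in a..b, u t
  set I2 := ∫ t in a..b, u t ^ 2 with hI2
  have hL : 0 < b - a := by linarith
  set m := I1 / (b - a) with hm
  have h : 0 ≤ ∫ t in a..b, (u t - m) ^ 2 :=
    intervalIntegral.integral_nonneg hab.le (fun t _ => sq_nonneg _)
  have e : ∫ t in a..b, (u t - m) ^ 2 = I2 - 2 * m * I1 + (b - a) * m ^ 2 := by
    have : ∀ t, (u t - m) ^ 2 = u t ^ 2 - 2 * m * u t + m ^ 2 := fun t => by ring
    simp only [this]
    rw [intervalIntegral.integral_add (h2.sub (h1.const_mul _)) (by simp),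
      intervalIntegral.integral_sub h2 (h1.const_mul _), intervalIntegral.integral_const_mul]
    simp [I1, I2]
  rw [e] at h
  have hI1 : I1 = (b - a) * m := by rw [hm]; field_simp
  rw [hI1] at h ⊢
  nlinarith

lemma domin {f : ℂ → ℂ} (hf : AnalyticOnNhd ℂ f (Metric.ball (0 : ℂ) 1))
    (hi : IntegrableOn (fun p : ℝ × ℝ => p.1 * ‖deriv f (ee p.1 p.2)‖ ^ 2)
      (Set.Ioo (0 : ℝ) 1 ×ˢ Set.Ioo (-Real.pi) Real.pi)) :
    ∃ M : ℝ → ℝ, Function.Periodic M (2 * Real.pi) ∧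
      IntervalIntegrable M volume (-Real.pi) Real.pi ∧
      ∀ᵐ θ ∂(volume.restrict (Set.Ioo (-Real.pi) Real.pi)),
        ∀ r : ℝ, 1 / 2 < r → r < 1 → ‖f (ee r θ)‖ ^ 2 ≤ M θ := by
  have hpi := Real.pi_pos
  obtain ⟨C, hC⟩ : ∃ C, ∀ z ∈ Metric.closedBall (0 : ℂ) (1 / 2), ‖f z‖ ≤ C :=
    (isCompact_closedBall _ _).exists_bound_of_continuousOn
      (hf.continuousOn.mono (Metric.closedBall_subset_ball (by norm_num)))
  have hS : IntegrableOn (fun p : ℝ × ℝ => ‖deriv f (ee p.1 p.2)‖ ^ 2)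
      (Set.Ioo (1 / 2 : ℝ) 1 ×ˢ Set.Ioo (-Real.pi) Real.pi) := by
    have hsub : Set.Ioo (1 / 2 : ℝ) 1 ×ˢ Set.Ioo (-Real.pi) Real.pi ⊆
        Set.Ioo (0 : ℝ) 1 ×ˢ Set.Ioo (-Real.pi) Real.pi :=
      Set.prod_mono (Set.Ioo_subset_Ioo_left (by norm_num)) subset_rfl
    refine Integrable.mono' ((hi.mono_set hsub).const_mul 2) ?_ ?_
    · refine ContinuousOn.aestronglyMeasurable ?_ (measurableSet_Ioo.prod measurableSet_Ioo)
      refine ((hf.deriv.continuousOn.norm).pow 2).comp ee_cont.continuousOn ?_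
      rintro p ⟨hp, -⟩
      exact ee_mem _ (by linarith [hp.1]) hp.2
    · refine (ae_restrict_iff' (measurableSet_Ioo.prod measurableSet_Ioo)).2 (ae_of_all _ ?_)
      rintro p ⟨hp, -⟩
      rw [Real.norm_of_nonneg (sq_nonneg _)]
      have := hp.1
      nlinarith [sq_nonneg ‖deriv f (ee p.1 p.2)‖]
  rw [IntegrableOn, Measure.volume_eq_prod, ← Measure.prod_restrict] at hS
  refine ⟨fun θ => 2 * C ^ 2 + ∫ t in Set.Ioo (1 / 2 : ℝ) 1, ‖deriv f (ee t θ)‖ ^ 2, ?_, ?_, ?_⟩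
  · intro θ; simp only [ee_per]
  · rw [intervalIntegrable_iff_integrableOn_Ioo_of_le (by linarith)]
    exact Integrable.add (integrable_const _) hS.integral_prod_right
  · filter_upwards [hS.prod_left_ae] with θ hθ r hr1 hr2
    set E := Complex.exp ((θ : ℂ) * Complex.I) with hE
    have hEn : ‖E‖ = 1 := Complex.norm_exp_ofReal_mul_I θ
    have hin : ∀ t ∈ Set.Icc (1 / 2) r, ee t θ ∈ Metric.ball (0 : ℂ) 1 :=
      fun t ht => ee_mem _ (by linarith [ht.1]) (by linarith [ht.2])
    have hec : Continuous (fun t : ℝ => ee t θ) := ee_cont.comp (Continuous.prodMk_left θ)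
    have hc : ContinuousOn (fun t : ℝ => deriv f (ee t θ)) (Set.Icc (1 / 2) r) :=
      hf.deriv.continuousOn.comp hec.continuousOn hin
    have ftc : ∫ t in (1 / 2)..r, deriv f (ee t θ) * E = f (ee r θ) - f (ee (1 / 2) θ) := by
      apply intervalIntegral.integral_eq_sub_of_hasDerivAt
      · intro t ht
        rw [Set.uIcc_of_le hr1.le] at ht
        exact HasDerivAt.comp t (h := fun t => ee t θ)
          (hf _ (hin t ht)).differentiableAt.hasDerivAt (ee_hd1 t θ)
      · apply ContinuousOn.intervalIntegrable
        rw [Set.uIcc_of_le hr1.le]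
        exact hc.mul continuousOn_const
    have h1 : ‖f (ee r θ) - f (ee (1 / 2) θ)‖ ≤ ∫ t in (1 / 2)..r, ‖deriv f (ee t θ)‖ := by
      rw [← ftc]
      refine (intervalIntegral.norm_integral_le_integral_norm hr1.le).trans (le_of_eq ?_)
      simp [hEn]
    have h2 := sq_int_le hr1 hc.norm
    have h3 : ∫ t in (1 / 2)..r, ‖deriv f (ee t θ)‖ ^ 2 ≤
        ∫ t in Set.Ioo (1 / 2 : ℝ) 1, ‖deriv f (ee t θ)‖ ^ 2 := by
      rw [intervalIntegral.integral_of_le hr1.le]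
      refine setIntegral_mono_set hθ (ae_of_all _ fun _ => sq_nonneg _) ?_
      exact LE.le.eventuallyLE (fun t ht => ⟨ht.1, ht.2.trans_lt hr2⟩)
    have h4 : ‖f (ee (1 / 2) θ)‖ ≤ C := hC _ (by simp [norm_ee])
    have h5 : 0 ≤ ∫ t in (1 / 2)..r, ‖deriv f (ee t θ)‖ ^ 2 :=
      intervalIntegral.integral_nonneg hr1.le (fun t _ => sq_nonneg _)
    have h6 : ‖f (ee r θ)‖ ≤ ‖f (ee r θ) - f (ee (1 / 2) θ)‖ + ‖f (ee (1 / 2) θ)‖ := by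
      simpa using norm_add_le (f (ee r θ) - f (ee (1 / 2) θ)) (f (ee (1 / 2) θ))
    set x := ‖f (ee r θ) - f (ee (1 / 2) θ)‖
    set y := ‖f (ee (1 / 2) θ)‖
    have hx : 0 ≤ x := norm_nonneg _
    have hy : 0 ≤ y := norm_nonneg _
    have h7 : x ^ 2 ≤ (∫ t in (1 / 2)..r, ‖deriv f (ee t θ)‖) ^ 2 := by gcongr
    have h8 : y ^ 2 ≤ C ^ 2 := by gcongr
    have h9 : ‖f (ee r θ)‖ ^ 2 ≤ (x + y) ^ 2 := by gcongr
    nlinarith [sq_nonneg (x - y)]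

lemma freq {f : ℂ → ℂ}
    (hi : IntegrableOn (fun p : ℝ × ℝ => p.1 * ‖deriv f (ee p.1 p.2)‖ ^ 2)
      (Set.Ioo (0 : ℝ) 1 ×ˢ Set.Ioo (-Real.pi) Real.pi)) :
    ∃ r : ℕ → ℝ, Tendsto r atTop (nhdsWithin 1 (Set.Iio 1)) ∧ ∀ n,
      1 / 2 < r n ∧ r n < 1 ∧
      (1 - r n) * ∫ θ in (0 : ℝ)..(2 * Real.pi), ‖deriv f (ee (r n) θ)‖ ^ 2 ≤ 2 := by
  have hpi := Real.pi_pos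
  refine exists_seq_forall_of_frequently (p := fun r => 1 / 2 < r ∧ r < 1 ∧
      (1 - r) * ∫ θ in (0 : ℝ)..(2 * Real.pi), ‖deriv f (ee r θ)‖ ^ 2 ≤ 2) ?_
  have hev : ∀ᶠ r : ℝ in nhdsWithin 1 (Set.Iio 1), 1 / 2 < r ∧ r < 1 := 
    Ioo_mem_nhdsLT (by norm_num)
  by_contra hcon
  rw [not_frequently] at hcon
  have hev2 := hev.and hcon
  obtain ⟨l, hl, hl2⟩ := (mem_nhdsLT_iff_exists_Ioo_subset' (show (0 : ℝ) < 1 by norm_num)).1 hev2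
  rw [Set.mem_Iio] at hl
  rw [IntegrableOn, Measure.volume_eq_prod, ← Measure.prod_restrict] at hi
  have hA := hi.integral_prod_left
  have hl3 : ∀ r ∈ Set.Ioo l 1, 0 < r ∧ r < 1 ∧
      (1 - r)⁻¹ ≤ ∫ θ in Set.Ioo (-Real.pi) Real.pi, r * ‖deriv f (ee r θ)‖ ^ 2 := by
    intro r hr
    obtain ⟨⟨h1, h2⟩, h3⟩ := hl2 hr
    refine ⟨by linarith, h2, ?_⟩
    have h3 : 2 < (1 - r) * ∫ θ in (0 : ℝ)..(2 * Real.pi), ‖deriv f (ee r θ)‖ ^ 2 := by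
      by_contra h; exact h3 ⟨h1, h2, not_lt.1 h⟩
    have per : Function.Periodic (fun θ => ‖deriv f (ee r θ)‖ ^ 2) (2 * Real.pi) := by
      intro y; simp only [ee_per]
    have hp := per.intervalIntegral_add_eq (-Real.pi) 0
    rw [show -Real.pi + 2 * Real.pi = Real.pi by ring, zero_add] at hp
    rw [← hp, intervalIntegral.integral_of_le (by linarith), integral_Ioc_eq_integral_Ioo] at h3
    rw [integral_const_mul, inv_le_iff_one_le_mul₀ (by linarith)]
    nlinarith
  have hnot : ¬ IntervalIntegrable (fun x : ℝ => (x - 1)⁻¹) volume l 1 := by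
    rw [intervalIntegrable_sub_inv_iff]
    simp [hl.ne]
  apply hnot
  rw [intervalIntegrable_iff_integrableOn_Ioo_of_le hl.le]
  have hl0 : Set.Ioo (max l 0) 1 = Set.Ioo l 1 := by
    ext x; constructor
    · rintro ⟨h1, h2⟩; exact ⟨(le_max_left _ _).trans_lt h1, h2⟩
    · intro h; exact ⟨max_lt h.1 (hl3 x h).1, h.2⟩
  have hA' : IntegrableOn (fun r => ∫ θ in Set.Ioo (-Real.pi) Real.pi, r * ‖deriv f (ee r θ)‖ ^ 2)
    (Set.Ioo l 1) := IntegrableOn.mono_set hA (fun x hx => ⟨(hl3 x hx).1, hx.2⟩)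
  refine Integrable.mono' hA' (by fun_prop) ?_
  refine (ae_restrict_iff' measurableSet_Ioo).2 (ae_of_all _ ?_)
  intro r hr
  obtain ⟨h1, h2, h3⟩ := hl3 r hr
  rw [norm_inv, Real.norm_eq_abs, abs_sub_comm, abs_of_pos (by linarith)]
  exact h3

lemma den_ne {a z : ℂ} (ha : ‖a‖ < 1) (hz : ‖z‖ ≤ 1) : 1 - (starRingEnd ℂ) a * z ≠ 0 := by
  intro h
  have h1 : (starRingEnd ℂ) a * z = 1 := (sub_eq_zero.1 h).symm
  have h2 : ‖a‖ * ‖z‖ = 1 := by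
    have := congrArg norm h1
    simpa using this
  nlinarith [norm_nonneg a, norm_nonneg z]

lemma blaschke_factor {a z : ℂ} (ha : ‖a‖ < 1) (hz : ‖z‖ = 1) :
    a - z ≠ 0 ∧ ‖(a - z) / (1 - (starRingEnd ℂ) a * z)‖ = 1 ∧
    ∃ t : ℝ, 0 ≤ t ∧ z * logDeriv (fun z => (a - z) / (1 - (starRingEnd ℂ) a * z)) z = t := by
  have hd := den_ne ha hz.le
  have hn : a - z ≠ 0 := by
    intro h; rw [sub_eq_zero.1 h] at ha; linarith
  have hzz : z * (starRingEnd ℂ) z = 1 := by rw [Complex.mul_conj', hz]; simp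
  have hz0 : z ≠ 0 := by rintro rfl; simp at hz
  have hcd : (starRingEnd ℂ) (1 - (starRingEnd ℂ) a * z) = 1 - a * (starRingEnd ℂ) z := by simp
  have hcd0 : 1 - a * (starRingEnd ℂ) z ≠ 0 := by
    rw [← hcd]; exact (map_ne_zero _).2 hd
  have hrel : a - z = - z * (1 - a * (starRingEnd ℂ) z) := by
    linear_combination - a * hzz
  refine ⟨hn, ?_, (1 - ‖a‖ ^ 2) / ‖1 - (starRingEnd ℂ) a * z‖ ^ 2, ?_, ?_⟩
  · rw [hrel, ← hcd, norm_div, norm_mul, RCLike.norm_conj, norm_neg, hz, one_mul]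
    exact div_self (norm_ne_zero_iff.2 hd)
  · have : ‖a‖ ^ 2 ≤ 1 := by nlinarith [norm_nonneg a]
    exact div_nonneg (by linarith) (sq_nonneg _)
  · have h1 : HasDerivAt (fun z => a - z) (-1) z := by
      simpa using (hasDerivAt_id z).const_sub a
    have h2 : HasDerivAt (fun z => 1 - (starRingEnd ℂ) a * z) (-(starRingEnd ℂ) a) z := by
      simpa using ((hasDerivAt_id z).const_mul ((starRingEnd ℂ) a)).const_sub 1
    rw [logDeriv_div z hn hd h1.differentiableAt h2.differentiableAt,
      logDeriv_apply, logDeriv_apply, h1.deriv, h2.deriv]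
    push_cast
    rw [← Complex.mul_conj' (1 - (starRingEnd ℂ) a * z), ← Complex.mul_conj' a, hcd, hrel]
    generalize (starRingEnd ℂ) a = b at *
    generalize (starRingEnd ℂ) z = y at *
    have e1 : z * (-1 / (-z * (1 - a * y)) - -b / (1 - b * z)) = 1 / (1 - a * y) + z * b / (1 - b * z) := by
      rw [mul_sub, neg_mul, neg_div_neg_eq, ← mul_div_assoc, ← mul_div_assoc, mul_one,
        div_mul_cancel_left₀ hz0]
      ring
    rw [e1, div_add_div _ _ hcd0 hd, mul_comm (1 - b * z) (1 - a * y)]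
    congr 1
    linear_combination (-a * b) * hzz

lemma blaschke_props (N : ℕ) (a : Fin N → ℂ) (ha : ∀ k, ‖a k‖ < 1) (c : ℂ) (hc : ‖c‖ = 1)
    (B : ℂ → ℂ)
    (hB : B = fun z => c * ∏ k, (a k - z) / (1 - (starRingEnd ℂ) (a k) * z)) :
    (AnalyticOnNhd ℂ B (Metric.closedBall 0 1)) ∧
    (∀ z, ‖z‖ = 1 → ‖B z‖ = 1) ∧
    (∀ z, ‖z‖ = 1 → star (B z) * (z * deriv B z) = (‖deriv B z‖ : ℂ)) := by
  have han : ∀ k, AnalyticOnNhd ℂ (fun z => (a k - z) / (1 - (starRingEnd ℂ) (a k) * z))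
      (Metric.closedBall 0 1) := by
    intro k z hz
    refine AnalyticAt.div (by fun_prop) (by fun_prop) (den_ne (ha k) ?_)
    simpa using hz
  have hnorm : ∀ z, ‖z‖ = 1 → ‖B z‖ = 1 := by
    intro z hz
    rw [hB]
    simp only [norm_mul, hc, one_mul, norm_prod]
    exact Finset.prod_eq_one (fun k _ => (blaschke_factor (ha k) hz).2.1)
  refine ⟨?_, hnorm, ?_⟩
  · rw [hB]
    intro z hz
    exact analyticAt_const.mul (Finset.analyticAt_fun_prod _ (fun k _ => han k z hz))
  · intro z hz
    have hc0 : c ≠ 0 := by rintro rfl; simp at hc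
    have hlog : ∃ t : ℝ, 0 ≤ t ∧ z * logDeriv B z = t := by
      choose t ht0 ht using fun k => (blaschke_factor (ha k) hz).2.2
      refine ⟨∑ k, t k, Finset.sum_nonneg (fun k _ => ht0 k), ?_⟩
      rw [hB, logDeriv_const_mul _ _ hc0, logDeriv_prod, Finset.mul_sum]
      · push_cast
        exact Finset.sum_congr rfl (fun k _ => ht k)
      · intro k _
        exact div_ne_zero (blaschke_factor (ha k) hz).1 (den_ne (ha k) hz.le)
      · intro k _
        exact (han k z (by simp [hz])).differentiableAt
    obtain ⟨t, ht0, ht⟩ := hlog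
    have hBn := hnorm z hz
    have hB0 : B z ≠ 0 := by intro h; rw [h] at hBn; simp at hBn
    have hd : z * deriv B z = t * B z := by
      rw [← ht, logDeriv_apply]; field_simp
    have hcB : star (B z) * B z = 1 := by
      have := Complex.conj_mul' (B z)
      rw [hBn] at this; simpa using this
    have h1 : star (B z) * (z * deriv B z) = t := by
      rw [hd]; linear_combination (t : ℂ) * hcB
    have h2 : ‖deriv B z‖ = t := by
      have := congrArg norm hd
      rw [norm_mul, norm_mul, hz, hBn] at this
      simpa [abs_of_nonneg ht0] using this
    rw [h1, h2]

lemma domin2 {f : ℂ → ℂ} (hf : AnalyticOnNhd ℂ f (Metric.ball (0 : ℂ) 1))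
    (hi : IntegrableOn (fun p : ℝ × ℝ => p.1 * ‖deriv f (ee p.1 p.2)‖ ^ 2)
      (Set.Ioo (0 : ℝ) 1 ×ˢ Set.Ioo (-Real.pi) Real.pi)) :
    ∃ M : ℝ → ℝ, IntervalIntegrable M volume 0 (2 * Real.pi) ∧
      ∀ᵐ θ : ℝ, θ ∈ Set.Ioc 0 (2 * Real.pi) →
        ∀ r : ℝ, 1 / 2 < r → r < 1 → ‖f (ee r θ)‖ ^ 2 ≤ M θ := by
  have hpi := Real.pi_pos
  obtain ⟨M, hper, hint, hM⟩ := domin hf hi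
  refine ⟨M, hper.intervalIntegrable (t := -Real.pi) (by positivity)
    (by rwa [show -Real.pi + 2 * Real.pi = Real.pi by ring]) _ _, ?_⟩
  rw [ae_restrict_iff' measurableSet_Ioo] at hM
  have hM2 := (measurePreserving_sub_right volume (2 * Real.pi)).quasiMeasurePreserving.ae hM
  have hne : ∀ᵐ θ : ℝ, θ ≠ Real.pi := by
    simp [ae_iff]
  filter_upwards [hM, hM2, hne] with θ h1 h2 h3 hθ r hr1 hr2
  rcases lt_or_gt_of_ne h3 with h | h
  · exact h1 ⟨by linarith [hθ.1], h⟩ r hr1 hr2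
  · have := h2 ⟨by linarith, by linarith [hθ.2]⟩ r hr1 hr2
    rwa [← hper (θ - 2 * Real.pi), ← ee_per r (θ - 2 * Real.pi), sub_add_cancel] at this

lemma circ_cont {E : Type*} [TopologicalSpace E] {h : ℂ → E}
    (hc : ContinuousOn h (Metric.ball (0 : ℂ) 1)) {r : ℝ} (h0 : 0 ≤ r) (h1 : r < 1) :
    Continuous (fun θ => h (ee r θ)) := by
  rw [← continuousOn_univ]
  exact hc.comp (ee_cont.comp (Continuous.prodMk_right r)).continuousOn (fun θ _ => ee_mem θ h0 h1)

lemma cover {r : ℕ → ℝ} (hr : Tendsto r atTop (nhdsWithin 1 (Set.Iio 1))) :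
    AECover (volume.restrict (Set.Ioo (0 : ℝ) 1 ×ˢ Set.Ioo (-Real.pi) Real.pi)) atTop
      (fun n => Set.Ioo (0 : ℝ) (r n) ×ˢ Set.Ioo (-Real.pi) Real.pi) := by
  constructor
  · refine (ae_restrict_iff' (measurableSet_Ioo.prod measurableSet_Ioo)).2 (ae_of_all _ ?_)
    rintro p ⟨hp, hp2⟩
    filter_upwards [(hr.mono_right nhdsWithin_le_nhds).eventually (lt_mem_nhds hp.2)] with n hn
    exact ⟨⟨hp.1, hn⟩, hp2⟩
  · exact fun n => measurableSet_Ioo.prod measurableSet_Ioo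

lemma restr_eq {R : ℝ} (hR : R < 1) :
    (volume.restrict (Set.Ioo (0 : ℝ) 1 ×ˢ Set.Ioo (-Real.pi) Real.pi)).restrict
      (Set.Ioo (0 : ℝ) R ×ˢ Set.Ioo (-Real.pi) Real.pi) =
    volume.restrict (Set.Ioo (0 : ℝ) R ×ˢ Set.Ioo (-Real.pi) Real.pi) := by
  rw [Measure.restrict_restrict (measurableSet_Ioo.prod measurableSet_Ioo),
    Set.inter_eq_left.2 (Set.prod_mono (Set.Ioo_subset_Ioo_right hR.le) subset_rfl)]

lemma split_int {f B : ℂ → ℂ} (hf : AnalyticOnNhd ℂ f (Metric.ball (0 : ℂ) 1))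
    (hB : AnalyticOnNhd ℂ B (Metric.ball (0 : ℂ) 1)) {R : ℝ} (h0 : 0 < R) (h1 : R < 1) :
    ∫ θ in (0 : ℝ)..(2 * Real.pi), star (f (ee R θ) * B (ee R θ)) *
      (ee R θ * deriv (fun w => f w * B w) (ee R θ)) =
    (∫ θ in (0 : ℝ)..(2 * Real.pi), star (f (ee R θ)) * (ee R θ * deriv f (ee R θ))) +
    (∫ θ in (0 : ℝ)..(2 * Real.pi), ((‖B (ee R θ)‖ ^ 2 - 1 : ℝ) : ℂ) *
      (star (f (ee R θ)) * (ee R θ * deriv f (ee R θ)))) +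
    (∫ θ in (0 : ℝ)..(2 * Real.pi), ((‖f (ee R θ)‖ ^ 2 : ℝ) : ℂ) *
      (star (B (ee R θ)) * (ee R θ * deriv B (ee R θ)))) := by
  have hz : Continuous (fun θ => ee R θ) := ee_cont.comp (Continuous.prodMk_right R)
  have c1 := circ_cont hf.continuousOn h0.le h1
  have c2 := circ_cont hf.deriv.continuousOn h0.le h1
  have c3 := circ_cont hB.continuousOn h0.le h1
  have c4 := circ_cont hB.deriv.continuousOn h0.le h1
  have k1 : Continuous (fun θ => star (f (ee R θ)) * (ee R θ * deriv f (ee R θ))) :=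
    c1.star.mul (hz.mul c2)
  have k2 : Continuous (fun θ => ((‖B (ee R θ)‖ ^ 2 - 1 : ℝ) : ℂ) *
      (star (f (ee R θ)) * (ee R θ * deriv f (ee R θ)))) :=
    (Complex.continuous_ofReal.comp ((c3.norm.pow 2).sub continuous_const)).mul k1
  have k3 : Continuous (fun θ => ((‖f (ee R θ)‖ ^ 2 : ℝ) : ℂ) *
      (star (B (ee R θ)) * (ee R θ * deriv B (ee R θ)))) :=
    (Complex.continuous_ofReal.comp (c1.norm.pow 2)).mul (c3.star.mul (hz.mul c4))
  rw [← intervalIntegral.integral_add (k1.intervalIntegrable _ _) (k2.intervalIntegrable _ _),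
    ← intervalIntegral.integral_add (Continuous.intervalIntegrable (Continuous.fun_add k1 k2) _ _)
      (k3.intervalIntegrable _ _)]
  · refine intervalIntegral.integral_congr (fun θ _ => ?_)
    have hm := ee_mem θ h0.le h1
    have hd : deriv (fun w => f w * B w) (ee R θ) =
        deriv f (ee R θ) * B (ee R θ) + f (ee R θ) * deriv B (ee R θ) :=
      deriv_fun_mul (hf _ hm).differentiableAt (hB _ hm).differentiableAt
    have e1 : star (f (ee R θ)) * f (ee R θ) = ((‖f (ee R θ)‖ : ℝ) : ℂ) ^ 2 :=
      Complex.conj_mul' _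
    have e2 : star (B (ee R θ)) * B (ee R θ) = ((‖B (ee R θ)‖ : ℝ) : ℂ) ^ 2 :=
      Complex.conj_mul' _
    simp only [hd, star_mul']
    push_cast
    rw [← e1, ← e2]
    ring

lemma main_lim {f B : ℂ → ℂ} (hf : AnalyticOnNhd ℂ f (Metric.ball (0 : ℂ) 1))
    (hi : IntegrableOn (fun p : ℝ × ℝ => p.1 * ‖deriv f (ee p.1 p.2)‖ ^ 2)
      (Set.Ioo (0 : ℝ) 1 ×ˢ Set.Ioo (-Real.pi) Real.pi))
    (fb : ℝ → ℂ)
    (hfb : ∀ᵐ (θ : ℝ) ∂(volume.restrict (Set.Ioc (0 : ℝ) (2 * Real.pi))),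
      Tendsto (fun r : ℝ => f (ee r θ)) (nhdsWithin 1 (Set.Iio 1)) (nhds (fb θ)))
    (hB : AnalyticOnNhd ℂ B (Metric.closedBall 0 1))
    (hB1 : ∀ z, ‖z‖ = 1 → ‖B z‖ = 1)
    (hB2 : ∀ z, ‖z‖ = 1 → star (B z) * (z * deriv B z) = (‖deriv B z‖ : ℂ)) :
    2 * ∫ p in Set.Ioo (0 : ℝ) 1 ×ˢ Set.Ioo (-Real.pi) Real.pi,
      p.1 * ‖deriv (fun w => f w * B w) (ee p.1 p.2)‖ ^ 2 =
    2 * (∫ p in Set.Ioo (0 : ℝ) 1 ×ˢ Set.Ioo (-Real.pi) Real.pi,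
      p.1 * ‖deriv f (ee p.1 p.2)‖ ^ 2) +
    ∫ θ in (0 : ℝ)..(2 * Real.pi), ‖fb θ‖ ^ 2 * ‖deriv B (ee 1 θ)‖ := by
  have hpi := Real.pi_pos
  have h2pi : (0 : ℝ) ≤ 2 * Real.pi := by positivity
  obtain ⟨M, hMi, hM⟩ := domin2 hf hi
  obtain ⟨r, hrt, hr⟩ := freq hi
  have hrt1 : Tendsto r atTop (nhds 1) := hrt.mono_right nhdsWithin_le_nhds
  have hBb : AnalyticOnNhd ℂ B (Metric.ball 0 1) := hB.mono Metric.ball_subset_closedBall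
  obtain ⟨K, hK⟩ := (isCompact_closedBall (0 : ℂ) 1).exists_bound_of_continuousOn
    hB.deriv.continuousOn
  obtain ⟨K1, hK1⟩ := (isCompact_closedBall (0 : ℂ) 1).exists_bound_of_continuousOn
    hB.continuousOn
  have hK0 : 0 ≤ K := (norm_nonneg _).trans (hK 0 (by simp))
  have hK10 : 0 ≤ K1 := (norm_nonneg _).trans (hK1 0 (by simp))
  have hmem : ∀ n θ, ee (r n) θ ∈ Metric.ball (0 : ℂ) 1 := fun n θ =>
    ee_mem θ (by linarith [(hr n).1]) (hr n).2.1
  have hmem1 : ∀ θ, ee 1 θ ∈ Metric.closedBall (0 : ℂ) 1 := fun θ => by simp [norm_ee]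
  -- Lipschitz
  have hBL : ∀ n θ, |‖B (ee (r n) θ)‖ ^ 2 - 1| ≤ K * (K1 + 1) * (1 - r n) := by
    intro n θ
    have h1 := Convex.norm_image_sub_le_of_norm_deriv_le (fun x hx => (hB x hx).differentiableAt)
      hK (convex_closedBall (0 : ℂ) 1) (hmem1 θ) (Metric.ball_subset_closedBall (hmem n θ))
    have h2 : ‖ee (r n) θ - ee 1 θ‖ = 1 - r n := by
      unfold ee
      rw [← sub_mul, norm_mul, Complex.norm_exp_ofReal_mul_I, mul_one, ← Complex.ofReal_sub,
        Complex.norm_real, Real.norm_eq_abs, abs_sub_comm, abs_of_pos (by linarith [(hr n).2.1])]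
    have h3 := abs_norm_sub_norm_le (B (ee (r n) θ)) (B (ee 1 θ))
    rw [hB1 (ee 1 θ) (by simp [norm_ee])] at h3
    rw [h2] at h1
    have h4 := hK1 _ (Metric.ball_subset_closedBall (hmem n θ))
    have h5 : ‖B (ee (r n) θ)‖ ^ 2 - 1 = (‖B (ee (r n) θ)‖ - 1) * (‖B (ee (r n) θ)‖ + 1) := by ring
    rw [h5, abs_mul, abs_of_nonneg (by positivity : 0 ≤ ‖B (ee (r n) θ)‖ + 1)]
    calc _ ≤ (K * (1 - r n)) * (K1 + 1) := by
          apply mul_le_mul (h3.trans h1) (by linarith) (by positivity)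
          exact mul_nonneg hK0 (by linarith [(hr n).2.1])
      _ = _ := by ring
  -- T1
  have T1 : Tendsto (fun n => ∫ θ in (0 : ℝ)..(2 * Real.pi), ((‖B (ee (r n) θ)‖ ^ 2 - 1 : ℝ) : ℂ) *
      (star (f (ee (r n) θ)) * (ee (r n) θ * deriv f (ee (r n) θ)))) atTop (nhds 0) := by
    set IM := ∫ θ in (0 : ℝ)..(2 * Real.pi), M θ
    have hb : Tendsto (fun n => K * (K1 + 1) * Real.sqrt (1 - r n) * (IM + 2)) atTop (nhds 0) := by
      have : Tendsto (fun n => K * (K1 + 1) * Real.sqrt (1 - r n) * (IM + 2)) atTop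
          (nhds (K * (K1 + 1) * Real.sqrt (1 - 1) * (IM + 2))) :=
        ((((tendsto_const_nhds.sub hrt1).sqrt).const_mul _).mul_const _)
      simpa using this
    refine squeeze_zero_norm (fun n => ?_) hb
    obtain ⟨hr1, hr2, hr3⟩ := hr n
    set s := Real.sqrt (1 - r n) with hs
    have hs0 : 0 ≤ s := Real.sqrt_nonneg _
    have hs2 : s ^ 2 = 1 - r n := Real.sq_sqrt (by linarith)
    have hKK : 0 ≤ K * (K1 + 1) := by positivity
    have hci : IntervalIntegrable (fun θ => ‖deriv f (ee (r n) θ)‖ ^ 2) volume 0 (2 * Real.pi) :=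
      ((circ_cont hf.deriv.continuousOn (by linarith) hr2).norm.pow 2).intervalIntegrable _ _
    have := intervalIntegral.norm_integral_le_of_norm_le
      (f := fun θ => ((‖B (ee (r n) θ)‖ ^ 2 - 1 : ℝ) : ℂ) *
      (star (f (ee (r n) θ)) * (ee (r n) θ * deriv f (ee (r n) θ))))
      (g := fun θ => K * (K1 + 1) * s * (M θ + s ^ 2 * ‖deriv f (ee (r n) θ)‖ ^ 2)) h2pi (by
        filter_upwards [hM] with θ hθ hθ'
        have hm := hθ hθ' _ hr1 hr2
        rw [norm_mul, norm_mul, norm_mul, Complex.norm_real, norm_star, norm_ee, Real.norm_eq_abs,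
          abs_of_pos (by linarith : 0 < r n)]
        have hb := hBL n θ
        rw [← hs2] at hb
        set x := ‖f (ee (r n) θ)‖
        set y := ‖deriv f (ee (r n) θ)‖
        have hx : 0 ≤ x := norm_nonneg _
        have hy : 0 ≤ y := norm_nonneg _
        calc _ ≤ (K * (K1 + 1) * s ^ 2) * (x * (1 * y)) := by gcongr
          _ = K * (K1 + 1) * s * (x * (s * y)) := by ring
          _ ≤ _ := by
            gcongr
            nlinarith [sq_nonneg (x - s * y), sq_nonneg (s * y), sq_nonneg x])
      ((hMi.add (hci.const_mul _)).const_mul _)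
    refine this.trans ?_
    rw [intervalIntegral.integral_const_mul, intervalIntegral.integral_add hMi (hci.const_mul _),
      intervalIntegral.integral_const_mul, hs2]
    gcongr
  -- T2
  have T2 : Tendsto (fun n => ∫ θ in (0 : ℝ)..(2 * Real.pi), ((‖f (ee (r n) θ)‖ ^ 2 : ℝ) : ℂ) *
      (star (B (ee (r n) θ)) * (ee (r n) θ * deriv B (ee (r n) θ)))) atTop
      (nhds (∫ θ in (0 : ℝ)..(2 * Real.pi), ((‖fb θ‖ ^ 2 * ‖deriv B (ee 1 θ)‖ : ℝ) : ℂ))) := by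
    apply intervalIntegral.tendsto_integral_filter_of_dominated_convergence
      (fun θ => M θ * (K1 * K))
    · refine Eventually.of_forall (fun n => ?_)
      have h0 : 0 ≤ r n := by linarith [(hr n).1]
      have hz : Continuous (fun θ => ee (r n) θ) := ee_cont.comp (Continuous.prodMk_right (r n))
      have c1 := circ_cont hf.continuousOn h0 (hr n).2.1
      have c3 := circ_cont hBb.continuousOn h0 (hr n).2.1
      have c4 := circ_cont hBb.deriv.continuousOn h0 (hr n).2.1
      apply Continuous.aestronglyMeasurable
      exact (Complex.continuous_ofReal.comp (c1.norm.pow 2)).mul (c3.star.mul (hz.mul c4))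
    · refine Eventually.of_forall (fun n => ?_)
      filter_upwards [hM] with θ hθ hθ'
      rw [Set.uIoc_of_le h2pi] at hθ'
      have hm := hθ hθ' _ (hr n).1 (hr n).2.1
      have hc := Metric.ball_subset_closedBall (hmem n θ)
      have h4 := hK1 _ hc
      have h5 := hK _ hc
      have h6 : ‖ee (r n) θ‖ ≤ 1 := by simpa using hc
      rw [norm_mul, norm_mul, norm_mul, Complex.norm_real, norm_star, Real.norm_of_nonneg (sq_nonneg _)]
      calc _ ≤ M θ * (K1 * (1 * K)) := by gcongr; exact (sq_nonneg _).trans hm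
        _ = _ := by ring
    · exact hMi.mul_const _
    · rw [ae_restrict_iff' measurableSet_Ioc] at hfb
      filter_upwards [hfb] with θ hθ hθ'
      rw [Set.uIoc_of_le h2pi] at hθ'
      have l1 := (hθ hθ').comp hrt
      have l2 : Tendsto (fun n => ee (r n) θ) atTop (nhds (ee 1 θ)) :=
        ((ee_cont.comp (Continuous.prodMk_left θ)).tendsto 1).comp hrt1
      have l3 := ((hB _ (hmem1 θ)).continuousAt.tendsto).comp l2
      have l4 := ((hB _ (hmem1 θ)).deriv.continuousAt.tendsto).comp l2
      rw [Complex.ofReal_mul, ← hB2 (ee 1 θ) (by simp [norm_ee])]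
      exact ((Complex.continuous_ofReal.tendsto _).comp (l1.norm.pow 2)).mul (l3.star.mul (l2.mul l4))
  have hfB : AnalyticOnNhd ℂ (fun w => f w * B w) (Metric.ball (0 : ℂ) 1) := hf.mul hBb
  set S := Set.Ioo (0 : ℝ) 1 ×ˢ Set.Ioo (-Real.pi) Real.pi with hS
  have L1 : Tendsto (fun n => ∫ p in Set.Ioo (0 : ℝ) (r n) ×ˢ Set.Ioo (-Real.pi) Real.pi,
      p.1 * ‖deriv f (ee p.1 p.2)‖ ^ 2) atTop (nhds (∫ p in S, p.1 * ‖deriv f (ee p.1 p.2)‖ ^ 2)) := by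
    have := (cover hrt).integral_tendsto_of_countably_generated hi
    refine this.congr (fun n => ?_)
    rw [restr_eq (hr n).2.1]
  have key : ∀ n, ((2 * ∫ p in Set.Ioo (0 : ℝ) (r n) ×ˢ Set.Ioo (-Real.pi) Real.pi,
      p.1 * ‖deriv (fun w => f w * B w) (ee p.1 p.2)‖ ^ 2 : ℝ) : ℂ) = _ := fun n =>
    (green hfB (by linarith [(hr n).1]) (hr n).2.1).trans
      ((split_int hf hBb (by linarith [(hr n).1]) (hr n).2.1).trans
      (by rw [← green hf (by linarith [(hr n).1]) (hr n).2.1]))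
  have L2 : Tendsto (fun n => ((2 * ∫ p in Set.Ioo (0 : ℝ) (r n) ×ˢ Set.Ioo (-Real.pi) Real.pi,
      p.1 * ‖deriv (fun w => f w * B w) (ee p.1 p.2)‖ ^ 2 : ℝ) : ℂ)) atTop
      (nhds (((2 * (∫ p in S, p.1 * ‖deriv f (ee p.1 p.2)‖ ^ 2) : ℝ) : ℂ) + 0 + 
        ∫ θ in (0 : ℝ)..(2 * Real.pi), ((‖fb θ‖ ^ 2 * ‖deriv B (ee 1 θ)‖ : ℝ) : ℂ))) := by
    simp only [key]
    exact (((Complex.continuous_ofReal.tendsto _).comp (L1.const_mul 2)).add T1).add T2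
  rw [intervalIntegral.integral_ofReal] at L2
  have L3 := (Complex.continuous_re.tendsto _).comp L2
  simp only [Function.comp_def, Complex.ofReal_re, Complex.add_re, add_zero] at L3
  set J := ∫ θ in (0 : ℝ)..(2 * Real.pi), ‖fb θ‖ ^ 2 * ‖deriv B (ee 1 θ)‖
  set I := ∫ p in S, p.1 * ‖deriv f (ee p.1 p.2)‖ ^ 2
  have L4 : Tendsto (fun n => ∫ p in Set.Ioo (0 : ℝ) (r n) ×ˢ Set.Ioo (-Real.pi) Real.pi,
      p.1 * ‖deriv (fun w => f w * B w) (ee p.1 p.2)‖ ^ 2) atTop (nhds ((2 * I + J) / 2)) := by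
    refine (L3.div_const 2).congr (fun n => ?_)
    ring
  have hgc : ContinuousOn (fun z => ‖deriv (fun w => f w * B w) z‖ ^ 2) (Metric.ball (0 : ℂ) 1) :=
    (hfB.deriv.continuousOn.norm).pow 2
  have := (cover hrt).integral_eq_of_tendsto_of_nonneg_ae
    (f := fun p => p.1 * ‖deriv (fun w => f w * B w) (ee p.1 p.2)‖ ^ 2) ((2 * I + J) / 2)
    (by
      refine (ae_restrict_iff' (measurableSet_Ioo.prod measurableSet_Ioo)).2 (ae_of_all _ ?_)
      rintro p ⟨hp, -⟩
      exact mul_nonneg hp.1.le (sq_nonneg _))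
    (fun n => by
      rw [IntegrableOn, restr_eq (hr n).2.1]
      have : IntegrableOn (fun p : ℝ × ℝ => p.1 * ‖deriv (fun w => f w * B w) (ee p.1 p.2)‖ ^ 2)
          (Set.Icc 0 (r n) ×ˢ Set.Icc (-Real.pi) Real.pi) :=
        ((polar_cont hgc).mono (Set.prod_mono (fun x hx => ⟨hx.1, hx.2.trans_lt (hr n).2.1⟩)
          (Set.subset_univ _))).integrableOn_compact (isCompact_Icc.prod isCompact_Icc)
      exact this.mono_set (Set.prod_mono Set.Ioo_subset_Icc_self Set.Ioo_subset_Icc_self))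
    (L4.congr (fun n => by rw [restr_eq (hr n).2.1]))
  rw [this]
  ring

/-- Carleson's formula for multiplication by a finite Blaschke product in the
Dirichlet space: ‖fB‖²_𝒟 = ‖f‖²_𝒟 + (1/(2π))∫_𝕋 |f|²|B'| |dζ|. -/
theorem carleson_formula_blaschke
    (f : ℂ → ℂ) (hf : AnalyticOnNhd ℂ f (Metric.ball (0 : ℂ) 1))
    (hDir : IntegrableOn (fun z => ‖deriv f z‖ ^ 2) (Metric.ball (0 : ℂ) 1) volume)
    (fb : ℝ → ℂ)
    (hfb : ∀ᵐ (θ : ℝ) ∂(volume.restrict (Set.Ioc (0 : ℝ) (2 * Real.pi))),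
      Tendsto (fun r : ℝ => f ((r : ℂ) * Complex.exp ((θ : ℂ) * Complex.I)))
        (nhdsWithin 1 (Set.Iio 1)) (nhds (fb θ)))
    (N : ℕ) (a : Fin N → ℂ) (ha : ∀ k, ‖a k‖ < 1) (c : ℂ) (hc : ‖c‖ = 1)
    (B : ℂ → ℂ)
    (hB : B = fun z => c * ∏ k, (a k - z) / (1 - (starRingEnd ℂ) (a k) * z)) :
    (1 / Real.pi) * ∫ z in Metric.ball (0 : ℂ) 1, ‖deriv (fun w => f w * B w) z‖ ^ 2 =
      (1 / Real.pi) * (∫ z in Metric.ball (0 : ℂ) 1, ‖deriv f z‖ ^ 2) +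
        (1 / (2 * Real.pi)) *
          ∫ θ in (0 : ℝ)..(2 * Real.pi),
            ‖fb θ‖ ^ 2 * ‖deriv B (Complex.exp (θ * Complex.I))‖ := by
  obtain ⟨h1, h2, h3⟩ := blaschke_props N a ha c hc B hB
  have hi := polar_integrable ((hf.deriv.continuousOn.norm).pow 2) hDir
  have key := main_lim hf hi fb hfb h1 h2 h3
  have e1 : ∀ θ : ℝ, ee 1 θ = Complex.exp (θ * Complex.I) := fun θ => by simp [ee]
  simp only [e1] at key
  rw [polar_int, polar_int]
  have hpi := Real.pi_pos.ne'
  generalize (∫ θ in (0 : ℝ)..(2 * Real.pi),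
    ‖fb θ‖ ^ 2 * ‖deriv B (Complex.exp (θ * Complex.I))‖) = J at *
  field_simp
  linarith
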